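/- The distribution of the number of descents on nonnesting permutations of {1,1,...,n,n} is symmetric: the number of nonnesting permutations with r descents equals the number with 2n - 2 - r descents, for all r. -/

import Mathlib

attribute [local instance] Classical.propDecidable

/-- The word 1^k 2^k ... n^k. -/
def baseWord (n k : ℕ) : List ℕ := (List.range n).flatMap (fun i => List.replicate k (i+1))

/-- All permutations of the multiset with k copies of each of 1,...,n. -/
noncomputable def multiPerms (n k : ℕ) : Finset (List ℕ) := (baseWord n k).permutations.toFinset

/-- Number of descents of a word. -/
def des (w : List ℕ) : ℕ := ((w.zip w.tail).filter (fun p => decide (p.2 < p.1))).length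
/-- Number of plateaus of a word. -/
def plat (w : List ℕ) : ℕ := ((w.zip w.tail).filter (fun p => decide (p.2 = p.1))).length
/-- Number of weak descents of a word. -/
def wdes (w : List ℕ) : ℕ := ((w.zip w.tail).filter (fun p => decide (p.2 ≤ p.1))).length

/-- Avoidance of the patterns 1221 and 2112: there are no positions i < j < l < m with
w_i = w_m, w_j = w_l and w_i ≠ w_j. -/
def avoids (w : List ℕ) : Prop := ∀ i j l m, i < j → j < l → l < m → m < w.length →
  w.getD i 0 = w.getD m 0 → w.getD j 0 = w.getD l 0 → w.getD i 0 = w.getD j 0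

/-- Nonnesting permutations of the multiset {1,1,...,n,n}. -/
noncomputable def nonnest (n : ℕ) : Finset (List ℕ) := (multiPerms n 2).filter avoids

section NonnestProof

open Finset

/-- Number of consecutive pairs of a word satisfying `R`. -/
noncomputable def dR (R : ℕ → ℕ → Prop) : List ℕ → ℕ
  | [] => 0
  | [_] => 0
  | u :: v :: w => (if R u v then 1 else 0) + dR R (v :: w)

lemma des_eq_dR (w : List ℕ) : des w = dR (fun u v => v < u) w := by
  induction w with
  | nil => simp [des, dR]
  | cons u w ih =>
    cases w with
    | nil => simp [des, dR]
    | cons v w =>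
      rw [dR, ← ih]
      unfold des
      simp only [List.tail_cons, List.zip_cons_cons, List.filter_cons]
      by_cases h : v < u <;> simp [h]
      omega

lemma wdes_eq_dR (w : List ℕ) : wdes w = dR (fun u v => v ≤ u) w := by
  induction w with
  | nil => simp [wdes, dR]
  | cons u w ih =>
    cases w with
    | nil => simp [wdes, dR]
    | cons v w =>
      rw [dR, ← ih]
      unfold wdes
      simp only [List.tail_cons, List.zip_cons_cons, List.filter_cons]
      by_cases h : v ≤ u <;> simp [h]
      omega

lemma dR_append_pair (R : ℕ → ℕ → Prop) (w : List ℕ) (u v : ℕ) :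
    dR R (w ++ [u, v]) = dR R (w ++ [u]) + (if R u v then 1 else 0) := by
  induction w with
  | nil => simp [dR]
  | cons a w ih =>
    cases w with
    | nil => simp [dR]
    | cons b w =>
      simp only [List.cons_append, dR] at ih ⊢
      omega

lemma wdes_add_des_reverse (w : List ℕ) : wdes w + des w.reverse = w.length - 1 := by
  rw [wdes_eq_dR, des_eq_dR]
  induction w with
  | nil => simp [dR]
  | cons u w ih =>
    cases w with
    | nil => simp [dR]
    | cons v w =>
      simp only [List.reverse_cons, List.append_assoc, List.cons_append, List.nil_append] at ih ⊢
      rw [dR_append_pair, dR]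
      simp only [List.length_cons] at ih ⊢
      by_cases h : v ≤ u
      · rw [if_pos h, if_neg (by omega)]; omega
      · rw [if_neg h, if_pos (by omega)]; omega

/-- Iterated sums, counting weakly increasing sequences of length `l` in `k` values. -/
def GG : ℕ → ℕ → ℕ
  | 0, _ => 1
  | l + 1, k => ∑ j ∈ range k, GG l (k - j)

lemma GG_zero (l : ℕ) : GG (l + 1) 0 = 0 := by simp [GG]

lemma GG_one (l : ℕ) : GG l 1 = 1 := by
  induction l with
  | zero => rfl
  | succ l ih => simp [GG, ih]

/-- Chains starting after `p`, with second components `w`, first components `< m`. -/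
noncomputable def fib (r : ℕ ×ₗ ℕ → ℕ ×ₗ ℕ → Prop) (m : ℕ) :
    List ℕ → ℕ ×ₗ ℕ → Finset (List (ℕ ×ₗ ℕ))
  | [], _ => {[]}
  | c :: w, p => ((range m).filter (fun a => r p (toLex (a, c)))).biUnion
      (fun a => (fib r m w (toLex (a, c))).image (fun L => toLex (a, c) :: L))

lemma mem_fib (r : ℕ ×ₗ ℕ → ℕ ×ₗ ℕ → Prop) (m : ℕ) (w : List ℕ) (p : ℕ ×ₗ ℕ)
    (L : List (ℕ ×ₗ ℕ)) : L ∈ fib r m w p ↔ List.IsChain r (p :: L) ∧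
      L.map (fun q => (ofLex q).2) = w ∧ ∀ q ∈ L, (ofLex q).1 < m := by
  induction w generalizing p L with
  | nil =>
    simp only [fib, mem_singleton, List.map_eq_nil_iff]
    constructor
    · rintro rfl; simp
    · rintro ⟨_, h, _⟩; exact h
  | cons c w ih =>
    simp only [fib, mem_biUnion, mem_filter, mem_range, mem_image, ih]
    constructor
    · rintro ⟨a, ⟨ha, hr⟩, L', ⟨h1, h2, h3⟩, rfl⟩
      refine ⟨List.isChain_cons_cons.2 ⟨hr, h1⟩, by simp [h2], ?_⟩
      intro q hq
      rcases List.mem_cons.1 hq with rfl | hq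
      · exact ha
      · exact h3 q hq
    · rintro ⟨h1, h2, h3⟩
      obtain ⟨q, L', rfl, rfl, h4⟩ := List.map_eq_cons_iff.1 h2
      rw [List.isChain_cons_cons] at h1
      exact ⟨(ofLex q).1, ⟨h3 q (by simp), h1.1⟩, L', ⟨h1.2, h4, fun q' hq' => h3 q' (by simp [hq'])⟩, rfl⟩

lemma card_fib (R : ℕ → ℕ → Prop) (r : ℕ ×ₗ ℕ → ℕ ×ₗ ℕ → Prop)
    (hr : ∀ a u b v, r (toLex (a, u)) (toLex (b, v)) ↔ a + (if R u v then 1 else 0) ≤ b)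
    (m : ℕ) (w : List ℕ) (a u : ℕ) :
    (fib r m w (toLex (a, u))).card = GG w.length (m - a - dR R (u :: w)) := by
  induction w generalizing a u with
  | nil => simp [fib, GG]
  | cons c w ih =>
    rw [fib, card_biUnion]
    · rw [List.length_cons, GG, dR]
      have : ∀ b, ((fib r m w (toLex (b, c))).image (fun L => toLex (b, c) :: L)).card
          = GG w.length (m - b - dR R (c :: w)) := by
        intro b
        rw [card_image_of_injective _ (List.cons_injective), ih]
      simp only [this, hr]
      generalize (if R u c then 1 else 0) = e
      have hd : w.length = 0 → dR R (c :: w) = 0 := by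
        intro h; rw [List.length_eq_zero_iff.1 h]; simp [dR]
      generalize dR R (c :: w) = d at hd
      generalize w.length = l at hd
      symm
      have key : ∑ j ∈ range (m - a - (e + d)), GG l (m - a - (e + d) - j)
          = ∑ b ∈ Ico (a + e) (m - d), GG l (m - b - d) := by
        rw [sum_Ico_eq_sum_range]
        have : m - d - (a + e) = m - a - (e + d) := by omega
        rw [this]
        refine sum_congr rfl fun j hj => ?_
        congr 1; omega
      rw [key]
      refine sum_subset ?_ ?_
      · intro b; simp only [mem_Ico, mem_filter, mem_range]; omega
      · intro b; simp only [mem_Ico, mem_filter, mem_range]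
        intro h1 h2
        cases l with
        | zero => exfalso; have := hd rfl; omega
        | succ l => rw [show m - b - d = 0 by omega, GG_zero]
    · intro b _ b' _ hne
      rw [Function.onFun, disjoint_left]
      intro L h1 h2
      simp only [mem_image] at h1 h2
      obtain ⟨L1, _, rfl⟩ := h1
      obtain ⟨L2, _, h⟩ := h2
      apply hne
      have := (List.cons.inj h).1
      have := congrArg (fun q => (ofLex q).1) this
      exact this.symm

/-- Triangular inversion. -/
lemma triangular {α : Type*} (S : Finset α) (f g : α → ℕ) (G : ℕ → ℕ) (h0 : G 0 = 0) (h1 : G 1 = 1)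
    (h : ∀ m, ∑ w ∈ S, G (m - f w) = ∑ w ∈ S, G (m - g w)) (d : ℕ) :
    (S.filter (fun w => f w = d)).card = (S.filter (fun w => g w = d)).card := by
  have expand : ∀ (k : α → ℕ) (m : ℕ), ∑ w ∈ S, G (m - k w)
      = ∑ j ∈ range m, (S.filter (fun w => k w = j)).card * G (m - j) := by
    intro k m
    have : ∀ j ∈ range m, (S.filter (fun w => k w = j)).card * G (m - j)
        = ∑ w ∈ S, if k w = j then G (m - k w) else 0 := by
      intro j _
      rw [← sum_filter, card_eq_sum_ones, sum_mul]
      refine sum_congr rfl fun w hw => ?_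
      rw [(mem_filter.1 hw).2, one_mul]
    rw [sum_congr rfl this, sum_comm]
    refine sum_congr rfl fun w _ => ?_
    rw [sum_ite_eq]
    split_ifs with hk
    · rfl
    · rw [mem_range] at hk
      rw [show m - k w = 0 by omega, h0]
  induction d using Nat.strong_induction_on with
  | _ d ih =>
    have := h (d + 1)
    rw [expand, expand, sum_range_succ, sum_range_succ] at this
    rw [sum_congr rfl (fun j hj => by rw [ih j (mem_range.1 hj)])] at this
    simpa [h1] using this

lemma avoids_iff (w : List ℕ) : avoids w ↔ ∀ u v, List.Sublist [u, v, v, u] w → u = v := by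
  constructor
  · intro h u v hs
    obtain ⟨f, hf⟩ := List.sublist_iff_exists_fin_orderEmbedding_get_eq.1 hs
    have e0 := hf ⟨0, by simp⟩
    have e1 := hf ⟨1, by simp⟩
    have e2 := hf ⟨2, by simp⟩
    have e3 := hf ⟨3, by simp⟩
    have l1 : f ⟨0, by simp⟩ < f ⟨1, by simp⟩ := f.strictMono (by simp [Fin.lt_def])
    have l2 : f ⟨1, by simp⟩ < f ⟨2, by simp⟩ := f.strictMono (by simp [Fin.lt_def])
    have l3 : f ⟨2, by simp⟩ < f ⟨3, by simp⟩ := f.strictMono (by simp [Fin.lt_def])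
    have := h _ _ _ _ l1 l2 l3 (f ⟨3, by simp⟩).2
    simp only [List.getD_eq_getElem _ _ (Fin.is_lt _)] at this
    simp only [List.get_eq_getElem] at e0 e1 e2 e3
    simp at e0 e1 e2 e3
    simp at this
    rw [← e0, ← e1, ← e2, ← e3] at this
    exact this rfl rfl
  · intro h i j l m hij hjl hlm hm e1 e2
    apply h
    have hi : i < w.length := by omega
    have hj : j < w.length := by omega
    have hl : l < w.length := by omega
    rw [List.getD_eq_getElem _ _ hi, List.getD_eq_getElem _ _ hm] at e1
    rw [List.getD_eq_getElem _ _ hj, List.getD_eq_getElem _ _ hl] at e2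
    rw [List.getD_eq_getElem _ _ hi, List.getD_eq_getElem _ _ hj]
    have : [w[i], w[j], w[j], w[i]] = [(⟨i, hi⟩ : Fin w.length), ⟨j, hj⟩, ⟨l, hl⟩, ⟨m, hm⟩].map w.get := by
      simp [e1, e2]
    rw [this]
    apply List.map_getElem_sublist
    simp [hij, hjl, hlm]
    omega

/-- The multiset of biletters attached to first and second values `x`, `y`. -/
def MM {n : ℕ} (x y : Fin n → ℕ) : Multiset (ℕ ×ₗ ℕ) :=
  (univ.val.map fun v : Fin n => toLex (x v, (v : ℕ) + 1)) +
    (univ.val.map fun v : Fin n => toLex (y v, (v : ℕ) + 1))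

lemma count_half {n : ℕ} (x : Fin n → ℕ) (v : Fin n) (a : ℕ) :
    (univ.val.map fun v : Fin n => toLex (x v, (v : ℕ) + 1)).count (toLex (a, (v : ℕ) + 1))
      = if x v = a then 1 else 0 := by
  rw [Multiset.count_map]
  have : (univ.val.filter fun u : Fin n => toLex (a, (v : ℕ) + 1) = toLex (x u, (u : ℕ) + 1))
      = univ.val.filter (fun u : Fin n => u = v ∧ x v = a) := by
    refine Multiset.filter_congr fun u _ => ?_
    rw [toLex_inj, Prod.mk.injEq]
    constructor
    · rintro ⟨h1, h2⟩
      have : v = u := Fin.ext (by omega)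
      subst this; exact ⟨rfl, h1.symm⟩
    · rintro ⟨rfl, h⟩; exact ⟨h.symm, rfl⟩
  rw [this]
  split_ifs with h
  · simp only [h, and_true]
    change (univ.filter fun u => u = v).card = 1
    rw [filter_eq' univ v]; simp
  · simp [h]

lemma count_MM {n : ℕ} (x y : Fin n → ℕ) (v : Fin n) (a : ℕ) :
    (MM x y).count (toLex (a, (v : ℕ) + 1))
      = (if x v = a then 1 else 0) + (if y v = a then 1 else 0) := by
  rw [MM, Multiset.count_add, count_half, count_half]

lemma mem_MM {n : ℕ} (x y : Fin n → ℕ) (q : ℕ ×ₗ ℕ) (hq : q ∈ MM x y) :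
    ∃ v : Fin n, (q = toLex (x v, (v : ℕ) + 1) ∨ q = toLex (y v, (v : ℕ) + 1)) := by
  simp only [MM, Multiset.mem_add, Multiset.mem_map] at hq
  rcases hq with ⟨v, _, h⟩ | ⟨v, _, h⟩
  · exact ⟨v, Or.inl h.symm⟩
  · exact ⟨v, Or.inr h.symm⟩

lemma MM_inj {n : ℕ} (x y x' y' : Fin n → ℕ) (h : ∀ v, x v ≤ y v) (h' : ∀ v, x' v ≤ y' v)
    (e : MM x y = MM x' y') : x = x' ∧ y = y' := by
  have key : ∀ v, x v = x' v ∧ y v = y' v := by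
    intro v
    have c : ∀ a, (if x v = a then 1 else 0) + (if y v = a then 1 else 0)
        = (if x' v = a then 1 else 0) + (if y' v = a then 1 else 0) := by
      intro a; rw [← count_MM, ← count_MM, e]
    have c1 := c (x v)
    have c2 := c (y v)
    have c3 := c (x' v)
    have c4 := c (y' v)
    have := h v
    have := h' v
    clear c
    generalize x v = p at *
    generalize y v = q at *
    generalize x' v = p' at *
    generalize y' v = q' at *
    grind
  exact ⟨funext fun v => (key v).1, funext fun v => (key v).2⟩

lemma nodup_MM {n : ℕ} (x y : Fin n → ℕ) : (MM x y).Nodup ↔ ∀ v, x v ≠ y v := by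
  rw [Multiset.nodup_iff_count_le_one]
  constructor
  · intro h v e
    have := h (toLex (x v, (v : ℕ) + 1))
    rw [count_MM] at this
    simp [e] at this
  · intro h q
    by_cases hq : q ∈ MM x y
    · obtain ⟨v, hv⟩ := mem_MM x y q hq
      have := h v
      rcases hv with rfl | rfl <;> rw [count_MM] <;> split_ifs <;> omega
    · rw [Multiset.count_eq_zero_of_notMem hq]; omega

lemma baseWord_succ (n : ℕ) : baseWord (n + 1) 2 = baseWord n 2 ++ [n + 1, n + 1] := by
  simp [baseWord, List.range_succ, List.flatMap_append, List.replicate]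

lemma count_baseWord (n a : ℕ) :
    Multiset.count a (baseWord n 2 : Multiset ℕ) = if 1 ≤ a ∧ a ≤ n then 2 else 0 := by
  induction n with
  | zero => simp [baseWord]; omega
  | succ n ih =>
    rw [baseWord_succ, ← Multiset.coe_add, Multiset.count_add, ih]
    have : (([n + 1, n + 1] : List ℕ) : Multiset ℕ) = Multiset.replicate 2 (n + 1) := rfl
    rw [this, Multiset.count_replicate]
    split_ifs <;> omega

lemma map_snd_MM {n : ℕ} (x y : Fin n → ℕ) :
    (MM x y).map (fun q => (ofLex q).2) = (baseWord n 2 : Multiset ℕ) := by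
  have : ∀ z : Fin n → ℕ, Multiset.map (fun q => (ofLex q).2)
      (univ.val.map fun v : Fin n => toLex (z v, (v : ℕ) + 1)) = (range n).val.map (· + 1) := by
    intro z
    rw [Multiset.map_map]
    have : (range n).val = (univ.val.map fun v : Fin n => (v : ℕ)) := by
      rw [Fin.univ_val_map, range_val, Multiset.range, List.ofFn_eq_map, List.map_coe_finRange_eq_range]
    rw [this, Multiset.map_map]; rfl
  rw [MM, Multiset.map_add, this, this]
  clear this x y
  induction n with
  | zero => simp [baseWord]
  | succ n ih =>
    rw [baseWord_succ, ← Multiset.coe_add, ← ih, range_val, range_val, Multiset.range_succ]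
    simp only [Multiset.map_cons]
    have : (([n + 1, n + 1] : List ℕ) : Multiset ℕ) = {n + 1} + {n + 1} := rfl
    rw [this, ← Multiset.singleton_add]
    abel

lemma mem_nonnest (n : ℕ) (w : List ℕ) : w ∈ nonnest n ↔
    (w : Multiset ℕ) = (baseWord n 2 : Multiset ℕ) ∧ avoids w := by
  simp [nonnest, multiPerms, Multiset.coe_eq_coe]

/-- The nesting condition on values. -/
def NN {n : ℕ} (x y : Fin n → ℕ) : Prop := ∀ u v : Fin n,
  toLex (x u, (u : ℕ)) ≤ toLex (x v, (v : ℕ)) → toLex (y v, (v : ℕ)) ≤ toLex (y u, (u : ℕ)) → u = v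

lemma lex_le (a u b v : ℕ) : toLex (a, u) ≤ toLex (b, v) ↔ a < b ∨ a = b ∧ u ≤ v :=
  Prod.Lex.toLex_le_toLex

lemma avoids_iff_NN {n : ℕ} (x y : Fin n → ℕ) (hxy : ∀ v, x v ≤ y v) (L : List (ℕ ×ₗ ℕ))
    (hL : L.Pairwise (· ≤ ·)) (hM : (L : Multiset (ℕ ×ₗ ℕ)) = MM x y) :
    avoids (L.map fun q => (ofLex q).2) ↔ NN x y := by
  rw [avoids_iff]
  constructor
  · intro h u v h1 h2
    by_contra hne
    have hne' : (u : ℕ) ≠ v := fun e => hne (Fin.ext e)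
    apply hne'
    have hs : List.Sublist [toLex (x u, (u : ℕ) + 1), toLex (x v, (v : ℕ) + 1),
        toLex (y v, (v : ℕ) + 1), toLex (y u, (u : ℕ) + 1)] L := by
      refine List.sublist_of_subperm_of_pairwise (r := (· ≤ ·)) ?_ ?_ hL
      · rw [← Multiset.coe_le, hM, Multiset.le_iff_count]
        intro q
        by_cases hq : ∃ (z : Fin n) (a : ℕ), q = toLex (a, (z : ℕ) + 1)
        · obtain ⟨z, a, rfl⟩ := hq
          rw [count_MM]
          simp only [← Multiset.cons_coe, Multiset.count_cons, toLex_inj, Prod.mk.injEq]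
          simp only [Multiset.coe_nil, Multiset.count_zero]
          by_cases hu : z = u
          · subst hu
            simp [hne', eq_comm, add_comm]
          · by_cases hv : z = v
            · subst hv
              simp [Ne.symm hne', eq_comm, add_comm]
            · have hu' : (z : ℕ) ≠ u := fun e => hu (Fin.ext e)
              have hv' : (z : ℕ) ≠ v := fun e => hv (Fin.ext e)
              simp [hu', hv']
        · rw [Multiset.count_eq_zero_of_notMem]
          · omega
          · intro hmem
            simp only [Multiset.mem_coe, List.mem_cons, List.not_mem_nil, or_false] at hmem
            apply hq
            rcases hmem with h | h | h | h <;> exact ⟨_, _, h⟩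
      · have := hxy u
        have := hxy v
        simp only [lex_le] at h1 h2
        simp [lex_le]
        omega
    have := h _ _ (by simpa using hs.map (fun q => (ofLex q).2))
    omega
  · intro h u v hs
    obtain ⟨L', hL', e⟩ := List.sublist_map_iff.1 hs
    obtain ⟨q1, L1, rfl, rfl, e1⟩ := List.map_eq_cons_iff.1 e.symm
    obtain ⟨q2, L2, rfl, rfl, e2⟩ := List.map_eq_cons_iff.1 e1
    obtain ⟨q3, L3, rfl, e3', e3⟩ := List.map_eq_cons_iff.1 e2
    obtain ⟨q4, L4, rfl, e4', e4⟩ := List.map_eq_cons_iff.1 e3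
    rw [List.map_eq_nil_iff] at e4
    subst e4
    by_contra hne
    have hp := hL.sublist hL'
    have hsub : (([q1, q2, q3, q4] : List (ℕ ×ₗ ℕ)) : Multiset (ℕ ×ₗ ℕ)) ≤ MM x y := by
      rw [← hM, Multiset.coe_le]; exact hL'.subperm
    have hc : ∀ q, Multiset.count q (([q1, q2, q3, q4] : List (ℕ ×ₗ ℕ)) : Multiset (ℕ ×ₗ ℕ))
        ≤ Multiset.count q (MM x y) := fun q => Multiset.count_le_of_le q hsub
    have m1 : q1 ∈ MM x y := Multiset.mem_of_le hsub (by simp)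
    have m2 : q2 ∈ MM x y := Multiset.mem_of_le hsub (by simp)
    obtain ⟨a, u⟩ := q1
    obtain ⟨b, v⟩ := q2
    obtain ⟨c, v'⟩ := q3
    obtain ⟨d, u'⟩ := q4
    change v' = v at e3'
    change u' = u at e4'
    change ¬ (u = v) at hne
    subst e3' e4'
    obtain ⟨i, hi⟩ := mem_MM _ _ _ m1
    obtain ⟨j, hj⟩ := mem_MM _ _ _ m2
    have hi' : u' = i + 1 := by
      rcases hi with hi | hi <;> exact congrArg (fun q => (ofLex q).2) hi
    have hj' : v' = j + 1 := by
      rcases hj with hi | hi <;> exact congrArg (fun q => (ofLex q).2) hi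
    subst hi' hj'
    change (([toLex (a, (i:ℕ) + 1), toLex (b, (j:ℕ) + 1), toLex (c, (j:ℕ) + 1), toLex (d, (i:ℕ) + 1)]
      : List (ℕ ×ₗ ℕ))).Pairwise (· ≤ ·) at hp
    change ∀ q, Multiset.count q (([toLex (a, (i:ℕ) + 1), toLex (b, (j:ℕ) + 1), toLex (c, (j:ℕ) + 1),
      toLex (d, (i:ℕ) + 1)] : List (ℕ ×ₗ ℕ)) : Multiset (ℕ ×ₗ ℕ)) ≤ Multiset.count q (MM x y) at hc
    have ci : ∀ t, (if t = a then 1 else 0) + (if t = d then 1 else 0)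
        ≤ (if x i = t then 1 else 0) + (if y i = t then 1 else 0) := by
      intro t
      have := hc (toLex (t, (i : ℕ) + 1))
      rw [count_MM] at this
      simp only [← Multiset.cons_coe, Multiset.count_cons, toLex_inj, Prod.mk.injEq] at this
      simp only [Multiset.coe_nil, Multiset.count_zero] at this
      have hne2 : ¬ ((i : ℕ) = j) := fun e => hne (by rw [e])
      simpa [hne2, add_comm] using this
    have cj : ∀ t, (if t = b then 1 else 0) + (if t = c then 1 else 0)
        ≤ (if x j = t then 1 else 0) + (if y j = t then 1 else 0) := by
      intro t
      have := hc (toLex (t, (j : ℕ) + 1))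
      rw [count_MM] at this
      simp only [← Multiset.cons_coe, Multiset.count_cons, toLex_inj, Prod.mk.injEq] at this
      simp only [Multiset.coe_nil, Multiset.count_zero] at this
      have hne2 : ¬ ((j : ℕ) = i) := fun e => hne (by rw [e])
      simpa [hne2, add_comm] using this
    simp [lex_le] at hp
    have ea : a = x i ∧ d = y i := by
      have h1 := ci a
      have h2 := ci d
      have := hxy i
      split_ifs at h1 h2 <;> omega
    have eb : b = x j ∧ c = y j := by
      have h1 := cj b
      have h2 := cj c
      have := hxy j
      split_ifs at h1 h2 <;> omega
    have hij := h i j (by rw [lex_le]; omega) (by rw [lex_le]; omega)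
    subst hij
    exact hne rfl

/-- Values `x ≤ y` bounded by `m`, satisfying the nonnesting condition. -/
noncomputable def XX (n m : ℕ) : Finset ((Fin n → ℕ) × (Fin n → ℕ)) :=
  ((Fintype.piFinset fun _ => range m) ×ˢ (Fintype.piFinset fun _ => range m)).filter
    fun p => (∀ v, p.1 v ≤ p.2 v) ∧ NN p.1 p.2

lemma mem_XX (n m : ℕ) (x y : Fin n → ℕ) : (x, y) ∈ XX n m ↔
    ((∀ v, x v < m) ∧ (∀ v, y v < m)) ∧ (∀ v, x v ≤ y v) ∧ NN x y := by
  simp [XX]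

/-- The sorted biword. -/
noncomputable def srt {n : ℕ} (p : (Fin n → ℕ) × (Fin n → ℕ)) : List (ℕ ×ₗ ℕ) :=
  (MM p.1 p.2).sort (· ≤ ·)

/-- The word of the sorted biword. -/
noncomputable def wrd {n : ℕ} (p : (Fin n → ℕ) × (Fin n → ℕ)) : List ℕ :=
  (srt p).map fun q => (ofLex q).2

lemma coe_srt {n : ℕ} (p : (Fin n → ℕ) × (Fin n → ℕ)) :
    (srt p : Multiset (ℕ ×ₗ ℕ)) = MM p.1 p.2 := Multiset.sort_eq _ _

lemma srt_pairwise {n : ℕ} (p : (Fin n → ℕ) × (Fin n → ℕ)) :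
    (srt p).Pairwise (· ≤ ·) := Multiset.pairwise_sort _ _

lemma wrd_mem {n m : ℕ} (p : (Fin n → ℕ) × (Fin n → ℕ)) (hp : p ∈ XX n m) :
    wrd p ∈ nonnest n := by
  obtain ⟨x, y⟩ := p
  rw [mem_XX] at hp
  rw [mem_nonnest]
  constructor
  · rw [wrd, ← Multiset.map_coe, coe_srt, map_snd_MM]
  · exact (avoids_iff_NN x y hp.2.1 _ (srt_pairwise _) (coe_srt _)).2 hp.2.2

/-- Every weakly sorted biword over a nonnesting word comes from values. -/
lemma exists_values {n m : ℕ} (L : List (ℕ ×ₗ ℕ)) (hL : L.Pairwise (· ≤ ·))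
    (hw : (L.map fun q => (ofLex q).2) ∈ nonnest n) (hm : ∀ q ∈ L, (ofLex q).1 < m) :
    ∃ p ∈ XX n m, srt p = L := by
  rw [mem_nonnest] at hw
  have hcount : ∀ k, (L.filter fun q => (ofLex q).2 = k).length = if 1 ≤ k ∧ k ≤ n then 2 else 0 := by
    intro k
    rw [← count_baseWord, ← hw.1, Multiset.coe_count, List.count, List.countP_map,
      ← List.countP_eq_length_filter]
    refine List.countP_congr fun q _ => ?_
    simp
  have hex : ∀ v : Fin n, ∃ a b, L.filter (fun q => (ofLex q).2 = (v : ℕ) + 1)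
      = [toLex (a, (v : ℕ) + 1), toLex (b, (v : ℕ) + 1)] := by
    intro v
    have h2 := hcount (v + 1)
    rw [if_pos (by omega)] at h2
    obtain ⟨q, q', e⟩ := List.length_eq_two.1 h2
    have hq : q ∈ L.filter (fun q => (ofLex q).2 = (v : ℕ) + 1) := by rw [e]; simp
    have hq' : q' ∈ L.filter (fun q => (ofLex q).2 = (v : ℕ) + 1) := by rw [e]; simp
    have s1 := (List.mem_filter.1 hq).2
    have s2 := (List.mem_filter.1 hq').2
    simp only [decide_eq_true_eq] at s1 s2
    refine ⟨(ofLex q).1, (ofLex q').1, ?_⟩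
    rw [e, ← s1]
    congr 2
    rw [s1, ← s2]; rfl
  choose x y hxy using hex
  have hle : ∀ v, x v ≤ y v := by
    intro v
    have := hL.filter (fun q => (ofLex q).2 = (v : ℕ) + 1)
    rw [hxy] at this
    simp [lex_le] at this
    omega
  have hmemx : ∀ v, toLex (x v, (v : ℕ) + 1) ∈ L := by
    intro v
    exact (List.mem_filter.1 (by rw [hxy]; simp : _ ∈ L.filter (fun q => (ofLex q).2 = (v : ℕ) + 1))).1
  have hmemy : ∀ v, toLex (y v, (v : ℕ) + 1) ∈ L := by
    intro v
    exact (List.mem_filter.1 (by rw [hxy]; simp : _ ∈ L.filter (fun q => (ofLex q).2 = (v : ℕ) + 1))).1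
  have hM : (L : Multiset (ℕ ×ₗ ℕ)) = MM x y := by
    ext q
    by_cases hq : ∃ (z : Fin n) (a : ℕ), q = toLex (a, (z : ℕ) + 1)
    · obtain ⟨z, a, rfl⟩ := hq
      rw [count_MM]
      have : Multiset.count (toLex (a, (z : ℕ) + 1)) (L : Multiset (ℕ ×ₗ ℕ)) =
          Multiset.count (toLex (a, (z : ℕ) + 1))
            ((L : Multiset (ℕ ×ₗ ℕ)).filter (fun q => (ofLex q).2 = (z : ℕ) + 1)) := by
        rw [Multiset.count_filter_of_pos]; rfl
      rw [this, Multiset.filter_coe, hxy]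
      simp only [← Multiset.cons_coe, Multiset.count_cons, toLex_inj, Prod.mk.injEq]
      simp [eq_comm, add_comm]
    · rw [Multiset.count_eq_zero_of_notMem, Multiset.count_eq_zero_of_notMem]
      · intro h
        obtain ⟨v, h | h⟩ := mem_MM _ _ _ h
        · exact hq ⟨v, _, h⟩
        · exact hq ⟨v, _, h⟩
      · intro h
        have h1 : 0 < (L.filter fun q' => (ofLex q').2 = (ofLex q).2).length :=
          List.length_pos_of_mem (List.mem_filter.2 ⟨h, by simp⟩)
        rw [hcount] at h1
        split_ifs at h1 with h2
        · apply hq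
          refine ⟨⟨(ofLex q).2 - 1, by omega⟩, (ofLex q).1, ?_⟩
          have : (ofLex q).2 - 1 + 1 = (ofLex q).2 := by omega
          simp only [this]; rfl
        · omega
  refine ⟨(x, y), ?_, ?_⟩
  · rw [mem_XX]
    exact ⟨⟨fun v => hm _ (hmemx v), fun v => hm _ (hmemy v)⟩, hle,
      (avoids_iff_NN x y hle L hL hM).1 hw.2⟩
  · refine List.Perm.eq_of_pairwise (le := (· ≤ ·)) (fun a b _ _ => le_antisymm) (srt_pairwise _) hL ?_
    rw [← Multiset.coe_eq_coe, coe_srt, hM]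

lemma srt_inj {n m : ℕ} (p p' : (Fin n → ℕ) × (Fin n → ℕ)) (hp : p ∈ XX n m) (hp' : p' ∈ XX n m)
    (h : srt p = srt p') : p = p' := by
  obtain ⟨x, y⟩ := p
  obtain ⟨x', y'⟩ := p'
  rw [mem_XX] at hp hp'
  have e : MM x y = MM x' y' := by
    have := congrArg (fun L : List (ℕ ×ₗ ℕ) => (L : Multiset (ℕ ×ₗ ℕ))) h
    simpa only [coe_srt] using this
  obtain ⟨rfl, rfl⟩ := MM_inj x y x' y' hp.2.1 hp'.2.1 e
  rfl

lemma nonnest_pos {n : ℕ} {w : List ℕ} (hw : w ∈ nonnest n) : ∀ c ∈ w, 0 < c := by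
  intro c hc
  rw [mem_nonnest] at hw
  have := Multiset.count_pos.2 (Multiset.mem_coe.2 hc)
  rw [hw.1, count_baseWord] at this
  split_ifs at this <;> omega

lemma nonnest_length {n : ℕ} {w : List ℕ} (hw : w ∈ nonnest n) : w.length = 2 * n := by
  rw [mem_nonnest] at hw
  rw [← Multiset.coe_card, hw.1, Multiset.coe_card]
  simp [baseWord, mul_comm]

lemma dR_zero_cons (R : ℕ → ℕ → Prop) (hR : ∀ c, 0 < c → ¬ R 0 c) (w : List ℕ) (hw : ∀ c ∈ w, 0 < c) :
    dR R (0 :: w) = dR R w := by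
  cases w with
  | nil => simp [dR]
  | cons c w => rw [dR, if_neg (hR c (hw c (by simp)))]; omega

lemma srt_lt {n m : ℕ} (p : (Fin n → ℕ) × (Fin n → ℕ)) (hp : p ∈ XX n m) :
    ∀ q ∈ srt p, (ofLex q).1 < m := by
  intro q hq
  obtain ⟨x, y⟩ := p
  rw [mem_XX] at hp
  rw [← Multiset.mem_coe, coe_srt] at hq
  obtain ⟨v, rfl | rfl⟩ := mem_MM _ _ _ hq
  · exact hp.1.1 v
  · exact hp.1.2 v

lemma card_fiber_le {n : ℕ} (m : ℕ) {w : List ℕ} (hw : w ∈ nonnest n) :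
    ((XX n m).filter fun p => wrd p = w).card = GG (2 * n) (m - des w) := by
  have hc := card_fib (fun u v => v < u) (· ≤ ·)
    (by intro a u b v; rw [lex_le]; split_ifs <;> omega) m w 0 0
  rw [nonnest_length hw, dR_zero_cons _ (by intro c hc; omega) _ (nonnest_pos hw), ← des_eq_dR,
    Nat.sub_zero] at hc
  rw [← hc]
  refine card_bij (fun p _ => srt p) ?_ ?_ ?_
  · intro p hp
    rw [mem_filter] at hp
    rw [mem_fib]
    refine ⟨?_, hp.2, srt_lt p hp.1⟩
    rw [List.isChain_iff_pairwise, List.pairwise_cons]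
    refine ⟨fun q hq => ?_, srt_pairwise p⟩
    have : toLex (0, 0) ≤ toLex ((ofLex q).1, (ofLex q).2) := by rw [lex_le]; omega
    exact this
  · intro p hp p' hp' h
    exact srt_inj p p' (mem_filter.1 hp).1 (mem_filter.1 hp').1 h
  · intro L hL
    rw [mem_fib] at hL
    obtain ⟨h1, h2, h3⟩ := hL
    rw [List.isChain_iff_pairwise, List.pairwise_cons] at h1
    obtain ⟨p, hp, rfl⟩ := exists_values (n := n) L h1.2 (by rw [h2]; exact hw) h3
    exact ⟨p, mem_filter.2 ⟨hp, h2⟩, rfl⟩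

lemma lex_lt (a u b v : ℕ) : toLex (a, u) < toLex (b, v) ↔ a < b ∨ a = b ∧ u < v :=
  Prod.Lex.toLex_lt_toLex

lemma srt_nodup {n : ℕ} (p : (Fin n → ℕ) × (Fin n → ℕ)) :
    (srt p).Nodup ↔ ∀ v, p.1 v ≠ p.2 v := by
  rw [← nodup_MM, ← coe_srt, Multiset.coe_nodup]

/-- Values with `x < y`. -/
noncomputable def YY (n m : ℕ) : Finset ((Fin n → ℕ) × (Fin n → ℕ)) :=
  (XX n m).filter fun p => ∀ v, p.1 v ≠ p.2 v

lemma card_fiber_lt {n : ℕ} (m : ℕ) {w : List ℕ} (hw : w ∈ nonnest n) :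
    ((YY n m).filter fun p => wrd p = w).card = GG (2 * n) (m - wdes w) := by
  have hc := card_fib (fun u v => v ≤ u) (· < ·)
    (by intro a u b v; rw [lex_lt]; split_ifs <;> omega) m w 0 0
  rw [nonnest_length hw, dR_zero_cons _ (by intro c hc; omega) _ (nonnest_pos hw), ← wdes_eq_dR,
    Nat.sub_zero] at hc
  rw [← hc]
  refine card_bij (fun p _ => srt p) ?_ ?_ ?_
  · intro p hp
    rw [mem_filter, YY, mem_filter] at hp
    obtain ⟨⟨hp1, hp2⟩, hp3⟩ := hp
    rw [mem_fib]
    refine ⟨?_, hp3, srt_lt p hp1⟩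
    rw [List.isChain_iff_pairwise, List.pairwise_cons]
    refine ⟨fun q hq => ?_, ?_⟩
    · have hpos : 0 < (ofLex q).2 := by
        apply nonnest_pos hw
        rw [← hp3]
        exact List.mem_map.2 ⟨q, hq, rfl⟩
      have : toLex (0, 0) < toLex ((ofLex q).1, (ofLex q).2) := by rw [lex_lt]; omega
      exact this
    · exact (List.Pairwise.and (srt_pairwise p) ((srt_nodup p).2 hp2)).imp
        fun h => lt_of_le_of_ne h.1 h.2
  · intro p hp p' hp' h
    exact srt_inj p p' (mem_filter.1 (mem_filter.1 hp).1).1 (mem_filter.1 (mem_filter.1 hp').1).1 h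
  · intro L hL
    rw [mem_fib] at hL
    obtain ⟨h1, h2, h3⟩ := hL
    rw [List.isChain_iff_pairwise, List.pairwise_cons] at h1
    obtain ⟨p, hp, rfl⟩ := exists_values (n := n) L (h1.2.imp le_of_lt) (by rw [h2]; exact hw) h3
    refine ⟨p, mem_filter.2 ⟨mem_filter.2 ⟨hp, ?_⟩, h2⟩, rfl⟩
    exact (srt_nodup p).1 (h1.2.imp ne_of_lt)

/-- The shift `y ↦ y + 1`. -/
lemma card_XX_eq_YY (n m : ℕ) : (XX n m).card = (YY n (m + 1)).card := by
  refine card_bij' (fun p _ => (p.1, fun v => p.2 v + 1)) (fun p _ => (p.1, fun v => p.2 v - 1))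
    ?_ ?_ ?_ ?_
  · rintro ⟨x, y⟩ hp
    rw [mem_XX] at hp
    obtain ⟨⟨h1, h2⟩, h3, h4⟩ := hp
    rw [YY, mem_filter, mem_XX]
    refine ⟨⟨⟨fun v => ?_, fun v => ?_⟩, fun v => ?_, fun u v a b => h4 u v a ?_⟩, fun v => ?_⟩
    · have := h1 v; dsimp only; omega
    · have := h2 v; dsimp only; omega
    · have := h3 v; dsimp only; omega
    · rw [lex_le] at b ⊢; dsimp only at b; omega
    · have := h3 v; dsimp only; omega
  · rintro ⟨x, y⟩ hp
    rw [YY, mem_filter, mem_XX] at hp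
    obtain ⟨⟨⟨h1, h2⟩, h3, h4⟩, h5⟩ := hp
    rw [mem_XX]
    dsimp only at h5 ⊢
    refine ⟨⟨fun v => ?_, fun v => ?_⟩, fun v => ?_, fun u v a b => h4 u v a ?_⟩
    · have := h2 v; have := h3 v; have := h5 v; omega
    · have := h2 v; have := h3 v; have := h5 v; omega
    · have := h3 v; have := h5 v; omega
    · have := h3 v; have := h5 v; have := h3 u; have := h5 u
      rw [lex_le] at b ⊢; dsimp only at b; omega
  · rintro ⟨x, y⟩ hp
    simp
  · rintro ⟨x, y⟩ hp
    rw [YY, mem_filter, mem_XX] at hp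
    obtain ⟨⟨⟨h1, h2⟩, h3, h4⟩, h5⟩ := hp
    dsimp only at h5 ⊢
    refine Prod.ext rfl (funext fun v => ?_)
    have := h3 v; have := h5 v; dsimp only; omega

lemma card_des_eq_card_wdes (n d : ℕ) (hn : 0 < n) :
    ((nonnest n).filter fun w => des w + 1 = d).card = ((nonnest n).filter fun w => wdes w = d).card := by
  obtain ⟨l, hl⟩ : ∃ l, 2 * n = l + 1 := ⟨2 * n - 1, by omega⟩
  refine triangular (nonnest n) (fun w => des w + 1) wdes (GG (2 * n)) (by rw [hl, GG_zero])
    (GG_one _) (fun m => ?_) d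
  cases m with
  | zero => simp
  | succ m =>
    have h1 : (XX n m).card = ∑ w ∈ nonnest n, GG (2 * n) (m - des w) := by
      rw [card_eq_sum_card_fiberwise (f := wrd) (t := nonnest n) (fun p hp => wrd_mem p hp)]
      exact sum_congr rfl fun w hw => card_fiber_le m hw
    have h2 : (YY n (m + 1)).card = ∑ w ∈ nonnest n, GG (2 * n) (m + 1 - wdes w) := by
      rw [card_eq_sum_card_fiberwise (f := wrd) (t := nonnest n)
        (fun p (hp : p ∈ YY n (m + 1)) => wrd_mem p (mem_filter.1 hp).1)]
      exact sum_congr rfl fun w hw => card_fiber_lt (m + 1) hw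
    rw [← h2, ← card_XX_eq_YY, h1]
    refine sum_congr rfl fun w _ => ?_
    congr 1; omega

lemma reverse_mem {n : ℕ} {w : List ℕ} (hw : w ∈ nonnest n) : w.reverse ∈ nonnest n := by
  rw [mem_nonnest] at hw ⊢
  refine ⟨by rw [Multiset.coe_reverse, hw.1], ?_⟩
  rw [avoids_iff] at hw ⊢
  intro u v h
  apply hw.2 u v
  simpa using h.reverse

end NonnestProof

/-- The distribution of descents on nonnesting permutations is symmetric around n - 1. -/
theorem des_symmetric (n r : ℕ) (hr : r ≤ 2 * n - 2) :
    ((nonnest n).filter (fun π => des π = r)).card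
      = ((nonnest n).filter (fun π => des π = 2 * n - 2 - r)).card := by
  rcases Nat.eq_zero_or_pos n with rfl | hn
  · have : r = 0 := by omega
    subst this; rfl
  · have h1 := card_des_eq_card_wdes n (r + 1) hn
    simp only [Nat.add_right_cancel_iff] at h1
    rw [h1]
    refine Finset.card_bij' (fun w _ => w.reverse) (fun w _ => w.reverse) ?_ ?_ ?_ ?_
    · intro w hw
      rw [Finset.mem_filter] at hw ⊢
      refine ⟨reverse_mem hw.1, ?_⟩
      have h2 := wdes_add_des_reverse w
      rw [nonnest_length hw.1] at h2
      omega
    · intro w hw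
      rw [Finset.mem_filter] at hw ⊢
      refine ⟨reverse_mem hw.1, ?_⟩
      have h2 := wdes_add_des_reverse w.reverse
      rw [List.reverse_reverse, List.length_reverse, nonnest_length hw.1] at h2
      omega
    · intro w _; simp
    · intro w _; simp
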